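/- For any non-trivial bicolouring of the once-punctured convex m-gon P*_m (m ≥ 2), the flip graph of permissible triangulations is connected: any two permissible triangulations are joined by a finite sequence of permissible triangulations in which consecutive triangulations share exactly m−2 arcs. -/

import Mathlib

/-!
Vertices of the once-punctured convex `m`-gon `P*_m` are identified with `ZMod m`.
An arc is an equivalence class `[(a,b)]` of pairs of integers with
`a < b ≤ a + m` and `b - a ≥ 2`, modulo `(a,b) ∼ (a+m, b+m)`.  Each class has a unique
representative with `0 ≤ a < m`; we identify arcs with these canonical representatives,
i.e. with pairs `p : ℤ × ℤ` satisfying `IsPArc m p` below.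
Blue is encoded by the Boolean value `true`, red by `false`.
-/

namespace Punc

/-- `p` is (the canonical representative of) an arc of `P*_m`:
`0 ≤ p.1 < m`, `p.1 < p.2 ≤ p.1 + m` and `p.2 - p.1 ≥ 2`. -/
def IsPArc (m : ℕ) (p : ℤ × ℤ) : Prop :=
  0 ≤ p.1 ∧ p.1 < (m : ℤ) ∧ p.1 + 2 ≤ p.2 ∧ p.2 ≤ p.1 + (m : ℤ)

/-- The arcs `[(a,b)] = p` and `[(c,d)] = q` cross: there is an integer `k` with
`a + km < c < b + km < d` or with `c < a + km < d < b + km`. -/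
def PCross (m : ℕ) (p q : ℤ × ℤ) : Prop :=
  ∃ k : ℤ, (p.1 + k * m < q.1 ∧ q.1 < p.2 + k * m ∧ p.2 + k * m < q.2) ∨
    (q.1 < p.1 + k * m ∧ p.1 + k * m < q.2 ∧ q.2 < p.2 + k * m)

/-- The arc `p` is the maximal arc based at `p.1 mod m`, i.e. `p.2 - p.1 = m`. -/
def IsMaximalArc (m : ℕ) (p : ℤ × ℤ) : Prop :=
  IsPArc m p ∧ p.2 - p.1 = (m : ℤ)

/-- A triangulation of `P*_m`: a set of `m - 1` pairwise non-crossing arcs. -/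
def IsPTriangulation (m : ℕ) (T : Finset (ℤ × ℤ)) : Prop :=
  T.card = m - 1 ∧ (∀ p ∈ T, IsPArc m p) ∧
    ∀ p ∈ T, ∀ q ∈ T, p ≠ q → ¬ PCross m p q

/-- A bicolouring: a function from the vertices to {red, blue} attaining both values
(`true` = blue, `false` = red). -/
def IsBicolouring (m : ℕ) (c : ZMod m → Bool) : Prop :=
  (∃ v, c v = true) ∧ (∃ v, c v = false)

/-- A bicolouring is non-trivial if some arc has both endpoints red. -/
def IsNontrivialBicolouring (m : ℕ) (c : ZMod m → Bool) : Prop :=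
  IsBicolouring m c ∧
    ∃ p : ℤ × ℤ, IsPArc m p ∧ c (p.1 : ZMod m) = false ∧ c (p.2 : ZMod m) = false

/-- An arc is permitted if at least one of its endpoints is blue. -/
def Permitted (m : ℕ) (c : ZMod m → Bool) (p : ℤ × ℤ) : Prop :=
  c (p.1 : ZMod m) = true ∨ c (p.2 : ZMod m) = true

/-- A permissible triangulation: a triangulation all of whose arcs are permitted. -/
def IsPermissible (m : ℕ) (c : ZMod m → Bool) (T : Finset (ℤ × ℤ)) : Prop :=
  IsPTriangulation m T ∧ ∀ p ∈ T, Permitted m c p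

/-- Two permissible triangulations are joined in the flip graph of permissible
triangulations: there is a finite sequence of permissible triangulations from one to the
other in which consecutive triangulations share exactly `m - 2` arcs. -/
def PermFlipJoined (m : ℕ) (c : ZMod m → Bool) (T₁ T₂ : Finset (ℤ × ℤ)) : Prop :=
  ∃ n : ℕ, ∃ f : Fin (n + 1) → Finset (ℤ × ℤ),
    f 0 = T₁ ∧ f (Fin.last n) = T₂ ∧ (∀ i, IsPermissible m c (f i)) ∧
    ∀ i : Fin n, (f i.castSucc ∩ f i.succ).card = m - 2

/-- The two integer intervals `(a, b)` and `(x, y)` interleave. -/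
def Interleave (a b x y : ℤ) : Prop :=
  (a < x ∧ x < b ∧ b < y) ∨ (x < a ∧ a < y ∧ y < b)

/-- The canonical representative of the class of `(a, b)`. -/
def canon (m : ℕ) (a b : ℤ) : ℤ × ℤ := (a % m, b - (a / m) * m)

/-- The periodic family of all representatives of the arcs in `T`. -/
def Lift (m : ℕ) (T : Finset (ℤ × ℤ)) (a b : ℤ) : Prop := canon m a b ∈ T

/-- A set of pairwise non-crossing arcs. -/
def Noncrossing (m : ℕ) (T : Finset (ℤ × ℤ)) : Prop :=
  (∀ p ∈ T, IsPArc m p) ∧ ∀ p ∈ T, ∀ q ∈ T, p ≠ q → ¬ PCross m p q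

/-- A periodic family of pairwise non-interleaving intervals of length between `2` and `m`. -/
structure Laminar (m : ℤ) (L : ℤ → ℤ → Prop) : Prop where
  two_le : ∀ {a b}, L a b → a + 2 ≤ b
  le_add : ∀ {a b}, L a b → b ≤ a + m
  shift : ∀ {a b} (k : ℤ), L a b → L (a + k * m) (b + k * m)
  nc : ∀ {a b x y}, L a b → L x y → a < x → x < b → b < y → False

/-- A laminar family to which no further interval can be added. -/
structure MaxLaminar (m : ℤ) (L : ℤ → ℤ → Prop) : Prop extends Laminar m L where
  max : ∀ {a b}, a + 2 ≤ b → b ≤ a + m → (∀ x y, L x y → ¬ Interleave x y a b) → L a b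

/-- `(a, b)` is a boundary edge or a member of `L`. -/
def Side (L : ℤ → ℤ → Prop) (a b : ℤ) : Prop := b = a + 1 ∨ L a b

lemma exists_shortest {P : ℤ → ℤ → Prop} (hP : ∀ a b, P a b → a ≤ b) (h : ∃ a b, P a b) :
    ∃ a b, P a b ∧ ∀ x y, P x y → b - a ≤ y - x := by
  classical
  have h' : ∃ n : ℕ, ∃ a b, P a b ∧ b - a = n := by
    obtain ⟨a, b, hab⟩ := h
    have := hP a b hab
    exact ⟨(b - a).toNat, a, b, hab, by omega⟩
  obtain ⟨a, b, hab, hn⟩ := Nat.find_spec h'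
  refine ⟨a, b, hab, fun x y hxy => ?_⟩
  have := hP x y hxy
  have := Nat.find_min' h' ⟨x, y, hxy, (Int.toNat_of_nonneg (by omega)).symm⟩
  omega

lemma exists_longest {P : ℤ → ℤ → Prop} {N : ℤ} (hP : ∀ a b, P a b → b ≤ a + N)
    (h : ∃ a b, P a b) : ∃ a b, P a b ∧ ∀ x y, P x y → y - x ≤ b - a := by
  obtain ⟨a, b, hab, hmin⟩ := exists_shortest (P := fun a b => P b (a + N))
    (fun a b hab => by have := hP _ _ hab; omega)
    (by obtain ⟨a, b, hab⟩ := h; exact ⟨b - N, a, by simpa using hab⟩)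
  refine ⟨b, a + N, hab, fun x y hxy => ?_⟩
  have := hmin (y - N) x (by simpa using hxy)
  omega

section Intervals

variable {m : ℤ} {L : ℤ → ℤ → Prop}

lemma exists_last_side {a b : ℤ} (hab : a + 2 ≤ b) :
    ∃ c, a < c ∧ c < b ∧ Side L a c ∧ ∀ x, c < x → x < b → ¬ L a x := by
  obtain ⟨u, c, ⟨hac, hcb, hs, rfl⟩, hmax⟩ := exists_longest (N := b - a)
    (P := fun u c => a < c ∧ c < b ∧ Side L a c ∧ u = a) (fun u c h => by omega)
    ⟨a, a + 1, by omega, by omega, Or.inl rfl, rfl⟩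
  refine ⟨c, hac, hcb, hs, fun x hcx hxb hx => ?_⟩
  have := hmax u x ⟨by omega, hxb, Or.inr hx, rfl⟩
  omega

lemma Laminar.eq_of_last_side (h : Laminar m L) {a b x y c : ℤ} (hab : L a b) (hxy : L x y)
    (hac : a < c) (hcb : c < b) (hsa : Side L a c) (hla : ∀ z, c < z → z < b → ¬ L a z)
    (hxc : x < c) (hcy : c < y) (hsx : Side L x c) (hlx : ∀ z, c < z → z < y → ¬ L x z) :
    a = x ∧ b = y := by
  have hax : a = x := by
    rcases lt_trichotomy a x with hlt | heq | hgt
    · rcases hsa with hs | hs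
      · omega
      · exact (h.nc hs hxy hlt hxc hcy).elim
    · exact heq
    · rcases hsx with hs | hs
      · omega
      · exact (h.nc hs hab hgt hac hcb).elim
  subst hax
  refine ⟨rfl, ?_⟩
  rcases lt_trichotomy b y with hlt | heq | hgt
  · exact (hlx b hcb hlt hab).elim
  · exact heq
  · exact (hla y hcy hgt hxy).elim

lemma Laminar.exists_uncovered (h : Laminar m L) :
    ∃ u, ∀ x y, L x y → ¬ (x < u ∧ u < y) := by
  by_cases hne : ∃ a b, L a b
  · obtain ⟨a, b, hab, hmax⟩ := exists_longest (N := m) (fun a b => h.le_add) hne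
    refine ⟨a, fun x y hxy ⟨h1, h2⟩ => ?_⟩
    have := hmax x y hxy
    exact h.nc hxy hab h1 h2 (by omega)
  · exact ⟨0, fun x y hxy => (hne ⟨x, y, hxy⟩).elim⟩

lemma MaxLaminar.exists_apex (h : MaxLaminar m L) {a b : ℤ} (hab : L a b) :
    ∃ c, a < c ∧ c < b ∧ Side L a c ∧ Side L c b := by
  obtain ⟨c, hac, hcb, hs, hlast⟩ := exists_last_side (L := L) (h.two_le hab)
  refine ⟨c, hac, hcb, hs, ?_⟩
  by_cases hc : b = c + 1
  · exact Or.inl hc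
  · have hlen := h.le_add hab
    refine Or.inr (h.max (by omega) (by omega) fun x y hxy hcr => ?_)
    rcases hcr with ⟨h1, h2, h3⟩ | ⟨h1, h2, h3⟩
    · rcases lt_trichotomy x a with hlt | rfl | hgt
      · exact h.nc hxy hab hlt (by omega) h3
      · exact hlast y h2 h3 hxy
      · rcases hs with hs | hs
        · omega
        · exact h.nc hs hxy hgt h1 h2
    · exact h.nc hab hxy (by omega) h2 h3

lemma MaxLaminar.mem_of_uncovered (h : MaxLaminar m L) {a : ℤ} (hm : 2 ≤ m)
    (ha : ∀ x y, L x y → ¬ (x < a ∧ a < y)) : L a (a + m) := by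
  refine h.max (by omega) le_rfl fun x y hxy hcr => ?_
  rcases hcr with ⟨h1, h2, h3⟩ | ⟨h1, h2, h3⟩
  · exact ha x y hxy ⟨h1, h2⟩
  · exact ha _ _ (h.shift (-1) hxy) ⟨by linarith, by linarith⟩

/-- An arc that is not maximal is a side of a triangle on its outer side. -/
lemma MaxLaminar.exists_parent (h : MaxLaminar m L) {a b : ℤ} (hab : L a b) (hlt : b < a + m) :
    (∃ p, b < p ∧ L a p ∧ Side L b p) ∨ (∃ p, p < a ∧ L p b ∧ Side L p a) := by
  have hlen := h.two_le hab
  have hex : ∃ x y, L x y ∧ x ≤ a ∧ b ≤ y ∧ b - a < y - x := by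
    by_contra! hno
    have hm := h.mem_of_uncovered (a := a) (by omega) (by
      rintro x y hxy ⟨h1, h2⟩
      by_cases hyb : y < b
      · exact h.nc hxy hab h1 h2 hyb
      · have := hno x y hxy h1.le (by omega)
        omega)
    have := hno a (a + m) hm le_rfl hlt.le
    omega
  obtain ⟨x, y, ⟨hxy, hxa, hby, hl⟩, hmin⟩ := exists_shortest
    (P := fun x y => L x y ∧ x ≤ a ∧ b ≤ y ∧ b - a < y - x) (fun x y hx => by omega) hex
  obtain ⟨c, hxc, hcy, hs1, hs2⟩ := h.exists_apex hxy
  by_cases hcb : b ≤ c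
  · rcases hs1 with hs1 | hs1
    · omega
    · have : ¬ (b - a < c - x) := fun hh => by
        have := hmin x c ⟨hs1, hxa, hcb, hh⟩
        omega
      obtain rfl : x = a := by omega
      obtain rfl : c = b := by omega
      exact Or.inl ⟨y, hcy, hxy, hs2⟩
  by_cases hca : c ≤ a
  · rcases hs2 with hs2 | hs2
    · omega
    · have : ¬ (b - a < y - c) := fun hh => by
        have := hmin c y ⟨hs2, hca, hby, hh⟩
        omega
      obtain rfl : c = a := by omega
      obtain rfl : y = b := by omega
      exact Or.inr ⟨x, hxc, hxy, hs1⟩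
  exfalso
  by_cases hxa' : x < a
  · rcases hs1 with hs1 | hs1
    · omega
    · exact h.nc hs1 hab hxa' (by omega) (by omega)
  · rcases hs2 with hs2 | hs2
    · omega
    · exact h.nc hab hs2 (by omega) (by omega) (by omega)

lemma Laminar.eq_of_interleave_left (h : Laminar m L) {p a c b x y : ℤ}
    (hac : a < c) (hcb : c < b) (hpb : L p b) (hspa : Side L p a) (hsac : Side L a c)
    (hscb : Side L c b) (hxy : L x y) (hcr : Interleave x y p c) : x = a ∧ y = b := by
  rcases hcr with ⟨h1, h2, h3⟩ | ⟨h1, h2, h3⟩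
  · exact (h.nc hxy hpb h1 h2 (by omega)).elim
  · have hyb : y ≤ b := by
      by_contra hh
      exact h.nc hpb hxy h1 (by omega) (by omega)
    have hax : a ≤ x := by
      by_contra hh
      rcases hspa with hs | hs
      · omega
      · exact h.nc hs hxy h1 (by omega) (by omega)
    have hxa : x ≤ a := by
      by_contra hh
      rcases hsac with hs | hs
      · omega
      · exact h.nc hs hxy (by omega) h2 h3
    have hby : b ≤ y := by
      by_contra hh
      rcases hscb with hs | hs
      · omega
      · exact h.nc hxy hs h2 h3 (by omega)
    omega

lemma Laminar.eq_of_interleave_right (h : Laminar m L) {p a c b x y : ℤ} (hac : a < c)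
    (hcb : c < b) (hap : L a p) (hsbp : Side L b p) (hsac : Side L a c)
    (hscb : Side L c b) (hxy : L x y) (hcr : Interleave x y c p) : x = a ∧ y = b := by
  rcases hcr with ⟨h1, h2, h3⟩ | ⟨h1, h2, h3⟩
  · have hax : a ≤ x := by
      by_contra hh
      exact h.nc hxy hap (by omega) (by omega) h3
    have hyb : y ≤ b := by
      by_contra hh
      rcases hsbp with hs | hs
      · omega
      · exact h.nc hxy hs (by omega) (by omega) h3
    have hby : b ≤ y := by
      by_contra hh
      rcases hscb with hs | hs
      · omega
      · exact h.nc hxy hs h1 h2 (by omega)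
    have hxa : x ≤ a := by
      by_contra hh
      rcases hsac with hs | hs
      · omega
      · exact h.nc hs hxy (by omega) h1 h2
    omega
  · exact (h.nc hap hxy (by omega) h2 h3).elim

lemma Laminar.eq_of_interleave_max (h : Laminar m L) {a v x y : ℤ} (hav : a < v)
    (hva : v < a + m) (ham : L a (a + m)) (hsav : Side L a v) (hsva : Side L v (a + m))
    (hxy : L x y) (hcr : Interleave x y v (v + m)) :
    ∃ k : ℤ, x = a + k * m ∧ y = a + m + k * m := by
  have key : ∀ x y, L x y → x < v → v < y → x = a ∧ y = a + m := by
    intro x y hxy h1 h2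
    have hl := h.le_add hxy
    have hax : a ≤ x := by
      by_contra hh
      exact h.nc hxy ham (by omega) (by omega) (by omega)
    have hxa : x ≤ a := by
      by_contra hh
      rcases hsav with hs | hs
      · omega
      · exact h.nc hs hxy (by omega) h1 h2
    have hay : a + m ≤ y := by
      by_contra hh
      rcases hsva with hs | hs
      · omega
      · exact h.nc hxy hs h1 h2 (by omega)
    omega
  rcases hcr with ⟨h1, h2, h3⟩ | ⟨h1, h2, h3⟩
  · obtain ⟨rfl, rfl⟩ := key x y hxy h1 h2
    exact ⟨0, by simp, by simp⟩
  · obtain ⟨h4, h5⟩ := key _ _ (h.shift (-1) hxy) (by linarith) (by linarith)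
    exact ⟨1, by linarith, by linarith⟩

end Intervals

section Canonical

variable {m : ℕ}

lemma canon_shift (hm : 0 < m) (a b k : ℤ) : canon m (a + k * m) (b + k * m) = canon m a b := by
  have : (m : ℤ) ≠ 0 := by omega
  unfold canon
  rw [Int.add_mul_emod_self_right, Int.add_mul_ediv_right _ _ this]
  ext <;> simp
  ring

lemma canon_eq_shift (a b : ℤ) :
    canon m a b = (a + (-(a / m)) * m, b + (-(a / m)) * m) := by
  unfold canon
  ext <;> simp
  · rw [Int.emod_def]; ring
  · ring

lemma canon_of_isPArc {p : ℤ × ℤ} (hp : IsPArc m p) : canon m p.1 p.2 = p := by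
  obtain ⟨h0, h1, -, -⟩ := hp
  unfold canon
  rw [Int.emod_eq_of_lt h0 h1, Int.ediv_eq_zero_of_lt h0 h1]
  simp

lemma isPArc_canon (hm : 0 < m) {a b : ℤ} (h1 : a + 2 ≤ b) (h2 : b ≤ a + m) :
    IsPArc m (canon m a b) := by
  have hm' : (0 : ℤ) < m := by omega
  have h3 := Int.emod_nonneg a hm'.ne'
  have h4 := Int.emod_lt_of_pos a hm'
  refine ⟨h3, h4, ?_, ?_⟩ <;> rw [canon_eq_shift] <;> simp only <;> linarith

lemma PCross.symm {p q : ℤ × ℤ} (h : PCross m p q) : PCross m q p := by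
  obtain ⟨k, h⟩ := h
  refine ⟨-k, h.symm.imp ?_ ?_⟩ <;> rintro ⟨h1, h2, h3⟩ <;>
    refine ⟨?_, ?_, ?_⟩ <;> linarith

lemma pcross_canon {a b x y : ℤ} (h : Interleave a b x y) :
    PCross m (canon m a b) (canon m x y) := by
  rw [canon_eq_shift a, canon_eq_shift x]
  refine ⟨a / m - x / m, h.imp ?_ ?_⟩ <;> rintro ⟨h1, h2, h3⟩ <;>
    refine ⟨?_, ?_, ?_⟩ <;> simp only <;> linarith

lemma exists_interleave_of_pcross {p : ℤ × ℤ} {x y : ℤ} (h : PCross m p (canon m x y)) :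
    ∃ k : ℤ, Interleave (p.1 + k * m) (p.2 + k * m) x y := by
  rw [canon_eq_shift] at h
  obtain ⟨k, h⟩ := h
  refine ⟨k + x / m, h.imp ?_ ?_⟩ <;> rintro ⟨h1, h2, h3⟩ <;>
    simp only at h1 h2 h3 <;> refine ⟨?_, ?_, ?_⟩ <;> linarith

lemma Noncrossing.insert_arc {T : Finset (ℤ × ℤ)} (h : Noncrossing m T) {p : ℤ × ℤ}
    (hp : IsPArc m p) (hT : ∀ q ∈ T, ¬ PCross m q p) : Noncrossing m (insert p T) := by
  refine ⟨?_, ?_⟩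
  · intro q hq
    rcases Finset.mem_insert.1 hq with rfl | hq
    · exact hp
    · exact h.1 q hq
  · intro q hq r hr hne hcr
    rcases Finset.mem_insert.1 hq with rfl | hq' <;>
      rcases Finset.mem_insert.1 hr with rfl | hr'
    · exact hne rfl
    · exact hT r hr' hcr.symm
    · exact hT q hq' hcr
    · exact h.2 q hq' r hr' hne hcr

lemma Noncrossing.lift_mem (hm : 0 < m) {T : Finset (ℤ × ℤ)} (h : Noncrossing m T) {p : ℤ × ℤ}
    (hp : p ∈ T) (k : ℤ) : Lift m T (p.1 + k * m) (p.2 + k * m) := by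
  unfold Lift
  rwa [canon_shift hm, canon_of_isPArc (h.1 p hp)]

lemma Noncrossing.laminar (hm : 0 < m) {T : Finset (ℤ × ℤ)} (h : Noncrossing m T) :
    Laminar m (Lift m T) := by
  have h2 : ∀ {a b}, Lift m T a b → a + 2 ≤ b := by
    intro a b hab
    have := (h.1 _ hab).2.2.1
    rw [canon_eq_shift] at this
    simp only at this
    linarith
  have h3 : ∀ {a b}, Lift m T a b → b ≤ a + m := by
    intro a b hab
    have := (h.1 _ hab).2.2.2
    rw [canon_eq_shift] at this
    simp only at this
    linarith
  refine ⟨h2, h3, ?_, ?_⟩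
  · intro a b k hab
    unfold Lift
    rwa [canon_shift hm]
  · intro a b x y hab hxy h4 h5 h6
    by_cases heq : canon m a b = canon m x y
    · rw [canon_eq_shift a, canon_eq_shift x] at heq
      obtain ⟨e1, e2⟩ := Prod.mk.inj heq
      have hl := h3 hab
      have hk : 0 < x / m - a / m := by
        by_contra hh
        have : (x / m - a / m) * m ≤ 0 := mul_nonpos_of_nonpos_of_nonneg (by omega) (by omega)
        linarith
      have : 1 * (m : ℤ) ≤ (x / m - a / m) * m :=
        mul_le_mul_of_nonneg_right (by omega) (by omega)
      linarith
    · exact h.2 _ hab _ hxy heq (pcross_canon (Or.inl ⟨h4, h5, h6⟩))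

lemma intCast_shift (a k : ℤ) : ((a + k * m : ℤ) : ZMod m) = a := by simp

lemma canon_fst_cast (a b : ℤ) : ((canon m a b).1 : ZMod m) = a := by
  rw [canon_eq_shift]
  exact intCast_shift _ _

lemma exists_eq_add_mul_of_cast_eq {x y : ℤ} (h : (x : ZMod m) = y) :
    ∃ k : ℤ, y = x + k * m := by
  obtain ⟨k, hk⟩ := (ZMod.intCast_eq_intCast_iff_dvd_sub x y m).1 h
  exact ⟨k, by linarith⟩

lemma Noncrossing.card_le (hm : 0 < m) {T : Finset (ℤ × ℤ)} (h : Noncrossing m T) :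
    T.card ≤ m - 1 := by
  classical
  have : NeZero m := ⟨hm.ne'⟩
  have hL := h.laminar hm
  have hlift : ∀ p ∈ T, Lift m T p.1 p.2 := fun p hp => by simpa using h.lift_mem hm hp 0
  have hex : ∀ p : ℤ × ℤ, ∃ c, p ∈ T → p.1 < c ∧ c < p.2 ∧ Side (Lift m T) p.1 c ∧
      ∀ x, c < x → x < p.2 → ¬ Lift m T p.1 x := by
    intro p
    by_cases hp : p ∈ T
    · obtain ⟨c, hc⟩ := exists_last_side (L := Lift m T) (hL.two_le (hlift p hp))
      exact ⟨c, fun _ => hc⟩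
    · exact ⟨0, fun hp' => (hp hp').elim⟩
  choose f hf using hex
  obtain ⟨u, hu⟩ := hL.exists_uncovered
  have hcard : (Finset.univ.erase (u : ZMod m)).card = m - 1 := by
    rw [Finset.card_erase_of_mem (Finset.mem_univ _), Finset.card_univ, ZMod.card]
  rw [← hcard]
  refine Finset.card_le_card_of_injOn (fun p => (f p : ZMod m)) ?_ ?_
  · intro p hp
    refine Finset.mem_coe.2 (Finset.mem_erase.2 ⟨fun heq => ?_, Finset.mem_univ _⟩)
    obtain ⟨k, hk⟩ := exists_eq_add_mul_of_cast_eq heq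
    obtain ⟨h1, h2, -, -⟩ := hf p hp
    exact hu _ _ (h.lift_mem hm hp k) ⟨by linarith, by linarith⟩
  · intro p hp q hq heq
    obtain ⟨k, hk⟩ := exists_eq_add_mul_of_cast_eq heq
    obtain ⟨h1, h2, h3, h4⟩ := hf p hp
    obtain ⟨h5, h6, h7, h8⟩ := hf q hq
    have hs : Side (Lift m T) (p.1 + k * m) (f q) := by
      rw [hk]
      rcases h3 with h3 | h3
      · exact Or.inl (by rw [h3]; ring)
      · exact Or.inr (hL.shift k h3)
    obtain ⟨e1, e2⟩ := hL.eq_of_last_side (h.lift_mem hm hp k) (hlift q hq)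
      (by linarith) (by linarith) hs (by
        intro z hz1 hz2 hz
        have := hL.shift (-k) hz
        rw [show p.1 + k * m + -k * m = p.1 by ring] at this
        exact h4 _ (by linarith) (by linarith) this) h5 h6 h7 h8
    rw [← canon_of_isPArc (h.1 p hp), ← canon_of_isPArc (h.1 q hq), ← e1, ← e2, canon_shift hm]

lemma IsPTriangulation.maxLaminar (hm : 0 < m) {T : Finset (ℤ × ℤ)}
    (h : IsPTriangulation m T) : MaxLaminar m (Lift m T) := by
  have hT : Noncrossing m T := h.2
  refine ⟨hT.laminar hm, ?_⟩
  intro a b h1 h2 hcr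
  by_contra hab
  have := (hT.insert_arc (isPArc_canon hm h1 h2) (by
    intro q hq hq'
    obtain ⟨k, hk⟩ := exists_interleave_of_pcross hq'
    exact hcr _ _ (hT.lift_mem hm hq k) hk)).card_le hm
  rw [Finset.card_insert_of_notMem hab, h.1] at this
  omega

end Canonical

section Flips

variable {m : ℕ} {c : ZMod m → Bool}

/-- Adjacency in the flip graph of permissible triangulations. -/
def PermFlip (m : ℕ) (c : ZMod m → Bool) (T T' : Finset (ℤ × ℤ)) : Prop :=
  IsPermissible m c T ∧ IsPermissible m c T' ∧ (T ∩ T').card = m - 2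

lemma PermFlip.symm {T T' : Finset (ℤ × ℤ)} (h : PermFlip m c T T') : PermFlip m c T' T :=
  ⟨h.2.1, h.1, by rw [Finset.inter_comm]; exact h.2.2⟩

/-- An arc that crosses exactly one arc of a permissible triangulation can be flipped in; this
lowers the number of arcs satisfying a predicate that holds for the old arc only. -/
lemma exists_flip (hm : 0 < m) {T : Finset (ℤ × ℤ)} (hT : IsPermissible m c T) {a b x y : ℤ}
    (hab : Lift m T a b) (hxy2 : x + 2 ≤ y) (hxym : y ≤ x + m)
    (hc : c (x : ZMod m) = true ∨ c (y : ZMod m) = true)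
    (hcr : ∀ z w, Lift m T z w → Interleave z w x y → ∃ k : ℤ, z = a + k * m ∧ w = b + k * m)
    (P : ℤ × ℤ → Prop) [DecidablePred P] (hPab : P (canon m a b)) (hPxy : ¬ P (canon m x y))
    (hxyT : ¬ Lift m T x y) :
    ∃ T', PermFlip m c T T' ∧ (∀ p ∈ T', p = canon m x y ∨ p ∈ T) ∧
      (T'.filter P).card < (T.filter P).card := by
  classical
  have hN : Noncrossing m T := hT.1.2
  have hsub : Noncrossing m (T.erase (canon m a b)) :=
    ⟨fun p hp => hN.1 p (Finset.mem_of_mem_erase hp),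
      fun p hp q hq => hN.2 p (Finset.mem_of_mem_erase hp) q (Finset.mem_of_mem_erase hq)⟩
  have hN' := hsub.insert_arc (isPArc_canon hm hxy2 hxym) (by
    intro q hq hq'
    obtain ⟨hne, hq⟩ := Finset.mem_erase.1 hq
    obtain ⟨k, hk⟩ := exists_interleave_of_pcross hq'
    obtain ⟨l, e1, e2⟩ := hcr _ _ (hN.lift_mem hm hq k) hk
    apply hne
    rw [← canon_of_isPArc (hN.1 q hq), ← canon_shift hm q.1 q.2 k, e1, e2, canon_shift hm])
  have hnot : canon m x y ∉ T.erase (canon m a b) := fun hh => hxyT (Finset.mem_of_mem_erase hh)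
  have hTcard := hT.1.1
  have hpos : 0 < T.card := Finset.card_pos.2 ⟨_, hab⟩
  have hecard : (T.erase (canon m a b)).card = m - 2 := by
    rw [Finset.card_erase_of_mem hab]; omega
  refine ⟨insert (canon m x y) (T.erase (canon m a b)), ⟨hT, ⟨⟨?_, hN'⟩, ?_⟩, ?_⟩,
    fun p hp => (Finset.mem_insert.1 hp).imp_right Finset.mem_of_mem_erase, ?_⟩
  · rw [Finset.card_insert_of_notMem hnot, hecard]; omega
  · intro p hp
    rcases Finset.mem_insert.1 hp with rfl | hp
    · unfold Permitted
      rw [canon_eq_shift]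
      simpa only [intCast_shift] using hc
    · exact hT.2 p (Finset.mem_of_mem_erase hp)
  · rw [Finset.inter_insert_of_notMem hxyT, Finset.inter_eq_right.2 (Finset.erase_subset _ _),
      hecard]
  · rw [Finset.filter_insert, if_neg hPxy, Finset.filter_erase]
    exact Finset.card_erase_lt_of_mem (Finset.mem_filter.2 ⟨hab, hPab⟩)

lemma exists_reachable_filter_eq_empty (P : ℤ × ℤ → Prop) [DecidablePred P]
    (Q : Finset (ℤ × ℤ) → Prop)
    (hstep : ∀ T, IsPermissible m c T → Q T → (∃ p ∈ T, P p) →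
      ∃ T', PermFlip m c T T' ∧ Q T' ∧ (T'.filter P).card < (T.filter P).card)
    (T : Finset (ℤ × ℤ)) (hT : IsPermissible m c T) (hQ : Q T) :
    ∃ S, Relation.ReflTransGen (PermFlip m c) T S ∧ IsPermissible m c S ∧ Q S ∧
      ∀ p ∈ S, ¬ P p := by
  induction hn : (T.filter P).card using Nat.strong_induction_on generalizing T with
  | _ n ih =>
    by_cases hex : ∃ p ∈ T, P p
    · obtain ⟨T', h1, h2, h3⟩ := hstep T hT hQ hex
      obtain ⟨S, hS, hrest⟩ := ih _ (hn ▸ h3) T' h1.2.1 h2 rfl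
      exact ⟨S, hS.head h1, hrest⟩
    · push Not at hex
      exact ⟨T, .refl, hT, hQ, hex⟩

/-- The arc `p` separates the vertex `v` from the puncture. -/
def Covers (m : ℕ) (v : ℤ) (p : ℤ × ℤ) : Prop := ∃ k : ℤ, p.1 + k * m < v ∧ v < p.2 + k * m

lemma covers_canon {v a b : ℤ} :
    Covers m v (canon m a b) ↔ ∃ k : ℤ, a + k * m < v ∧ v < b + k * m := by
  rw [canon_eq_shift]
  constructor
  · rintro ⟨k, h1, h2⟩
    exact ⟨k - a / m, by linarith, by linarith⟩
  · rintro ⟨k, h1, h2⟩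
    exact ⟨k + a / m, by simp only; linarith, by simp only; linarith⟩

lemma not_covers_of_endpoint {a b v : ℤ} (hm : b ≤ a + m) (hv : v = a ∨ v = b) :
    ¬ Covers m v (canon m a b) := by
  rw [covers_canon]
  rintro ⟨k, h1, h2⟩
  have hm0 : (0 : ℤ) ≤ m := by positivity
  rcases hv with rfl | rfl
  · have hk : k < 0 := by
      by_contra hh
      have : 0 ≤ k * (m : ℤ) := mul_nonneg (by omega) hm0
      linarith
    have : k * (m : ℤ) ≤ (-1) * m := mul_le_mul_of_nonneg_right (by omega) hm0
    linarith
  · have hk : 0 < k := by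
      by_contra hh
      have : k * (m : ℤ) ≤ 0 := mul_nonpos_of_nonpos_of_nonneg (by omega) hm0
      linarith
    have : 1 * (m : ℤ) ≤ k * m := mul_le_mul_of_nonneg_right (by omega) hm0
    linarith

lemma exists_flip_uncovering (hm : 2 ≤ m) {v : ℤ} (hv : c (v : ZMod m) = true)
    [DecidablePred (Covers m v)] {T : Finset (ℤ × ℤ)} (hT : IsPermissible m c T)
    (hex : ∃ p ∈ T, Covers m v p) :
    ∃ T', PermFlip m c T T' ∧
      (T'.filter (Covers m v)).card < (T.filter (Covers m v)).card := by
  have hm0 : 0 < m := by omega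
  have hN : Noncrossing m T := hT.1.2
  have hL := hT.1.maxLaminar hm0
  obtain ⟨a, b, ⟨hab, hav, hvb⟩, hmin⟩ := exists_shortest
    (P := fun a b => Lift m T a b ∧ a < v ∧ v < b) (fun a b h => by omega)
    (by
      obtain ⟨p, hp, k, h1, h2⟩ := hex
      exact ⟨_, _, hN.lift_mem hm0 hp k, h1, h2⟩)
  have hcov : Covers m v (canon m a b) := covers_canon.2 ⟨0, by linarith, by linarith⟩
  obtain ⟨w, haw, hwb, hs1, hs2⟩ := hL.exists_apex hab
  obtain rfl : w = v := by
    rcases lt_trichotomy w v with hlt | heq | hgt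
    · rcases hs2 with hs2 | hs2
      · omega
      · have := hmin w b ⟨hs2, hlt, hvb⟩
        omega
    · exact heq
    · rcases hs1 with hs1 | hs1
      · omega
      · have := hmin a w ⟨hs1, hav, hgt⟩
        omega
  suffices h : ∃ x y, (x = w ∨ y = w) ∧ x + 2 ≤ y ∧ y ≤ x + m ∧ ¬ Lift m T x y ∧
      ∀ z t, Lift m T z t → Interleave z t x y → ∃ k : ℤ, z = a + k * m ∧ t = b + k * m by
    obtain ⟨x, y, hw, h2, hlen, hnot, hcr⟩ := h
    obtain ⟨T', h1, -, h3⟩ := exists_flip hm0 hT hab h2 hlen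
      (by rcases hw with rfl | rfl; exacts [Or.inl hv, Or.inr hv]) hcr _ hcov
      (not_covers_of_endpoint hlen (by omega)) hnot
    exact ⟨T', h1, h3⟩
  have hlen := hL.le_add hab
  rcases hlen.lt_or_eq with hlt | rfl
  · rcases hL.exists_parent hab hlt with ⟨p, hbp, hap, hs⟩ | ⟨p, hpa, hpb, hs⟩
    · have hlp := hL.le_add hap
      refine ⟨w, p, Or.inl rfl, by omega, by omega,
        fun hh => hL.nc hab hh haw hwb hbp, ?_⟩
      intro x y hxy hcr
      have := hL.eq_of_interleave_right hav hvb hap hs hs1 hs2 hxy hcr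
      exact ⟨0, by simpa using this⟩
    · have hlp := hL.le_add hpb
      refine ⟨p, w, Or.inr rfl, by omega, by omega,
        fun hh => hL.nc hh hab hpa haw hwb, ?_⟩
      intro x y hxy hcr
      have := hL.eq_of_interleave_left hav hvb hpb hs hs1 hs2 hxy hcr
      exact ⟨0, by simpa using this⟩
  · refine ⟨w, w + m, Or.inl rfl, by omega, le_rfl,
        fun hh => hL.nc hab hh haw hwb (by omega), ?_⟩
    intro x y hxy hcr
    exact hL.eq_of_interleave_max hav hvb hab hs1 hs2 hxy hcr

lemma exists_flip_towards_fan (hm : 2 ≤ m) {v : ℤ} (hv : c (v : ZMod m) = true)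
    [DecidablePred fun p : ℤ × ℤ => (p.1 : ZMod m) ≠ v]
    {T : Finset (ℤ × ℤ)} (hT : IsPermissible m c T) (hunc : ∀ p ∈ T, ¬ Covers m v p)
    (hex : ∃ p ∈ T, (p.1 : ZMod m) ≠ v) :
    ∃ T', PermFlip m c T T' ∧ (∀ p ∈ T', ¬ Covers m v p) ∧
      (T'.filter fun p => (p.1 : ZMod m) ≠ v).card <
        (T.filter fun p => (p.1 : ZMod m) ≠ v).card := by
  have hm0 : 0 < m := by omega
  have hN : Noncrossing m T := hT.1.2
  have hL := hT.1.maxLaminar hm0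
  obtain ⟨a, b, ⟨hab, hav⟩, hmax⟩ := exists_longest (N := m)
    (P := fun a b => Lift m T a b ∧ (a : ZMod m) ≠ v) (fun a b h => hL.le_add h.1)
    (by
      obtain ⟨p, hp, hne⟩ := hex
      exact ⟨_, _, hN.lift_mem hm0 hp 0, by simpa using hne⟩)
  have hlt : b < a + m := by
    refine (hL.le_add hab).lt_of_ne fun heq => hunc _ hab (covers_canon.2 ⟨(v - a) / m, ?_⟩)
    have h1 := Int.emod_add_mul_ediv (v - a) m
    have h2 := Int.emod_nonneg (v - a) (b := m) (by omega)
    have h3 := Int.emod_lt_of_pos (v - a) (b := m) (by omega)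
    have h4 : (v - a) % m ≠ 0 := fun h0 =>
      hav ((ZMod.intCast_eq_intCast_iff_dvd_sub a v m).2 (Int.dvd_of_emod_eq_zero h0))
    have h5 : 0 < (v - a) % m := lt_of_le_of_ne h2 h4.symm
    constructor <;> linarith
  rcases hL.exists_parent hab hlt with ⟨p, hbp, hap, hs⟩ | ⟨p, hpa, hpb, hs⟩
  · have := hmax a p ⟨hap, hav⟩
    omega
  have hpv : (p : ZMod m) = v := by
    by_contra hne
    have := hmax p b ⟨hpb, hne⟩
    omega
  obtain ⟨w, haw, hwb, hs1, hs2⟩ := hL.exists_apex hab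
  have hlp := hL.le_add hpb
  obtain ⟨T', h1, h2, h3⟩ := exists_flip hm0 hT hab (x := p) (y := w) (by omega) (by omega)
    (Or.inl (hpv ▸ hv))
    (fun x y hxy hcr => ⟨0, by
      simpa using hL.eq_of_interleave_left haw hwb hpb hs hs1 hs2 hxy hcr⟩)
    (fun q : ℤ × ℤ => (q.1 : ZMod m) ≠ v) (by rwa [canon_fst_cast])
    (by rw [canon_fst_cast]; exact fun h => h hpv) (fun hh => hL.nc hh hab hpa haw hwb)
  refine ⟨T', h1, fun q hq => ?_, h3⟩
  rcases h2 q hq with rfl | hq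
  · obtain ⟨k, hk⟩ := exists_eq_add_mul_of_cast_eq hpv
    rw [← canon_shift hm0 p w k]
    exact not_covers_of_endpoint (by omega) (Or.inl hk)
  · exact hunc q hq

/-- Triangulations all of whose arcs start at `v` have the same arcs. -/
lemma subset_of_fan (hm : 0 < m) {v : ℤ} {S T : Finset (ℤ × ℤ)} (hS : IsPTriangulation m S)
    (hT : IsPTriangulation m T) (hSv : ∀ p ∈ S, (p.1 : ZMod m) = v)
    (hTv : ∀ p ∈ T, (p.1 : ZMod m) = v) : S ⊆ T := by
  intro p hp
  have hpa := hS.2.1 p hp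
  have hL := hT.maxLaminar hm
  rw [← canon_of_isPArc hpa]
  refine hL.max hpa.2.2.1 hpa.2.2.2 fun x y hxy hcr => ?_
  have hx : (x : ZMod m) = p.1 := by
    rw [hSv p hp, ← canon_fst_cast x y]
    exact hTv _ hxy
  have hlx := hL.le_add hxy
  have hlp := hpa.2.2.2
  obtain ⟨k, hk⟩ := exists_eq_add_mul_of_cast_eq hx
  rcases hcr with ⟨h1, h2, -⟩ | ⟨h1, h2, -⟩
  · exact not_covers_of_endpoint hlx (Or.inl rfl) (covers_canon.2 ⟨-k, by linarith, by linarith⟩)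
  · exact not_covers_of_endpoint hlp (Or.inl rfl) (covers_canon.2 ⟨k, by linarith, by linarith⟩)

lemma exists_reachable_fan (hm : 2 ≤ m) {v : ℤ} (hv : c (v : ZMod m) = true)
    {T : Finset (ℤ × ℤ)} (hT : IsPermissible m c T) :
    ∃ S, Relation.ReflTransGen (PermFlip m c) T S ∧ IsPermissible m c S ∧
      ∀ p ∈ S, (p.1 : ZMod m) = v := by
  classical
  obtain ⟨S, h1, h2, -, h3⟩ := exists_reachable_filter_eq_empty (c := c) (Covers m v)
    (fun _ => True) (fun T hT _ hex => by
      obtain ⟨T', h1, h2⟩ := exists_flip_uncovering hm hv hT hex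
      exact ⟨T', h1, trivial, h2⟩) T hT trivial
  obtain ⟨U, h4, h5, -, h6⟩ := exists_reachable_filter_eq_empty (c := c)
    (fun p : ℤ × ℤ => (p.1 : ZMod m) ≠ v) (fun T => ∀ p ∈ T, ¬ Covers m v p)
    (fun T hT hQ hex => exists_flip_towards_fan hm hv hT hQ hex) S h2 h3
  exact ⟨U, h1.trans h4, h5, fun p hp => not_not.1 (h6 p hp)⟩

/-- A path in the flip graph, listed as a sequence. -/
lemma permFlipJoined_of_reflTransGen {T T' : Finset (ℤ × ℤ)} (hT' : IsPermissible m c T')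
    (h : Relation.ReflTransGen (PermFlip m c) T T') : PermFlipJoined m c T T' := by
  induction h using Relation.ReflTransGen.head_induction_on with
  | refl => exact ⟨0, fun _ => T', rfl, rfl, fun _ => hT', fun i => i.elim0⟩
  | @head T S hTS _ ih =>
    obtain ⟨n, f, h0, hl, hp, hi⟩ := ih
    refine ⟨n + 1, Fin.cons T f, rfl, by rw [← Fin.succ_last, Fin.cons_succ, hl], ?_, ?_⟩
    · exact Fin.cases (by simpa using hTS.1) (by simpa using hp)
    · refine Fin.cases ?_ fun i => ?_
      · simpa [h0] using hTS.2.2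
      · simpa [← Fin.succ_castSucc] using hi i

end Flips

/-- For any non-trivial bicolouring of `P*_m` (`m ≥ 2`), the flip
graph of permissible triangulations is connected: any two permissible triangulations are
joined by a finite sequence of permissible triangulations in which consecutive
triangulations share exactly `m - 2` arcs. -/
theorem perm_flip_graph_connected (m : ℕ) (hm : 2 ≤ m) (c : ZMod m → Bool)
    (hc : IsNontrivialBicolouring m c)
    (T₁ T₂ : Finset (ℤ × ℤ))
    (hT₁ : IsPermissible m c T₁) (hT₂ : IsPermissible m c T₂) :
    PermFlipJoined m c T₁ T₂ := by
  obtain ⟨⟨⟨w, hw⟩, -⟩, -⟩ := hc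
  obtain ⟨v, rfl⟩ := ZMod.intCast_surjective w
  obtain ⟨S₁, h1, hS₁, hv₁⟩ := exists_reachable_fan hm hw hT₁
  obtain ⟨S₂, h2, hS₂, hv₂⟩ := exists_reachable_fan hm hw hT₂
  obtain rfl : S₁ = S₂ :=
    (subset_of_fan (by omega) hS₁.1 hS₂.1 hv₁ hv₂).antisymm
      (subset_of_fan (by omega) hS₂.1 hS₁.1 hv₂ hv₁)
  have : Std.Symm (PermFlip m c) := ⟨fun _ _ h => h.symm⟩
  exact permFlipJoined_of_reflTransGen hT₂ (h1.trans (Std.Symm.symm _ _ h2))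

end Punc
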